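/- arXiv:0807.3298 — 2 statements merged into one kernel-verified Lean document; each statement's English description precedes it below -/
import Mathlib

section
/- Let 𝕋¹ = ℝ/ℤ carry the quotient metric and the probability Haar measure μ, and for each positive integer k let T^k : 𝕋¹ → 𝕋¹ be the expanding circle map α ↦ kα. Then for every point x ∈ 𝕋¹ and every nonincreasing radius sequence r : ℕ₊ → ℝ_{≥0} (i.e. r(k) ≥ r(k+1) for all k) with ∑_{k=1}^∞ μ(B(x, r(k))) = ∞, for μ-almost every α ∈ 𝕋¹ the set { k ∈ ℕ₊ : kα ∈ B(x, r(k)) } is infinite. (That is, the system (𝕋¹, μ, (ℕ,*), T) has the monotone shrinking target property.) -/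
open MeasureTheory Metric

/-- counting -/
lemma mstp_card_le (G : Finset ℝ) (c a b : ℝ) (hc : 0 ≤ c) (hab : a ≤ b)
    (hinj : Set.InjOn (fun p : ℝ => ⌊c * p⌋) G) (h : ∀ p ∈ G, a ≤ p ∧ p ≤ b) :
    (G.card : ℝ) ≤ c * (b - a) + 2 := by
  have h1 : G.card ≤ (Finset.Icc ⌊c * a⌋ ⌊c * b⌋).card := by
    apply Finset.card_le_card_of_injOn (fun p : ℝ => ⌊c * p⌋) _ hinj
    intro p hp
    have := h p hp
    simp only [Finset.coe_Icc, Set.mem_Icc]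
    exact ⟨Int.floor_le_floor (by gcongr; exact this.1), Int.floor_le_floor (by gcongr; exact this.2)⟩
  rw [Int.card_Icc] at h1
  have h2 : ⌊c * a⌋ ≤ ⌊c * b⌋ := Int.floor_le_floor (by gcongr)
  have h3 : (G.card : ℤ) ≤ ⌊c * b⌋ + 1 - ⌊c * a⌋ := by omega
  have h4 : (G.card : ℝ) ≤ ⌊c * b⌋ + 1 - ⌊c * a⌋ := by exact_mod_cast h3
  have h5 := Int.floor_le (c * b)
  have h6 := Int.lt_floor_add_one (c * a)
  linarith

/-- Chung-Erdos -/
lemma mstp_CE {ι : Type*} (s : Finset ι) (A : ι → Set ℝ) (hA : ∀ i, MeasurableSet (A i))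
    (hfin : ∀ i, volume (A i) ≠ ⊤) (V : Set ℝ) (hV : MeasurableSet V) (hVfin : volume V ≠ ⊤)
    (hAV : ∀ i ∈ s, A i ⊆ V) :
    (∑ i ∈ s, volume.real (A i)) ^ 2 ≤
      volume.real V * ∑ i ∈ s, ∑ j ∈ s, volume.real (A i ∩ A j) := by
  set S := ∑ i ∈ s, volume.real (A i) with hS
  set Q := ∑ i ∈ s, ∑ j ∈ s, volume.real (A i ∩ A j) with hQ
  have key : ∀ t : ℝ, 0 ≤ volume.real V * (t * t) + (-2 * S) * t + Q := by
    intro t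
    have hint : ∀ B : Set ℝ, MeasurableSet B → volume B ≠ ⊤ →
        Integrable (B.indicator (1 : ℝ → ℝ)) volume := fun B hB hf => by
      rw [integrable_indicator_iff hB]
      exact integrableOn_const hf
    have hintI : ∀ B : Set ℝ, MeasurableSet B → 
        ∫ a, (B.indicator (1 : ℝ → ℝ)) a = volume.real B := fun B hB => integral_indicator_one hB
    have e : ∀ a, ((∑ i ∈ s, (A i).indicator (1 : ℝ → ℝ) a) - t * V.indicator (1 : ℝ → ℝ) a) ^ 2
        = (∑ i ∈ s, ∑ j ∈ s, (A i ∩ A j).indicator (1 : ℝ → ℝ) a)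
          - (2 * t) * (∑ i ∈ s, (A i).indicator (1 : ℝ → ℝ) a)
          + (t * t) * V.indicator (1 : ℝ → ℝ) a := by
      intro a
      have e1 : ∑ i ∈ s, ∑ j ∈ s, (A i ∩ A j).indicator (1 : ℝ → ℝ) a =
          (∑ i ∈ s, (A i).indicator (1 : ℝ → ℝ) a) * (∑ i ∈ s, (A i).indicator (1 : ℝ → ℝ) a) := by
        rw [Finset.sum_mul_sum]
        refine Finset.sum_congr rfl fun i _ => Finset.sum_congr rfl fun j _ => ?_
        rw [Set.inter_indicator_one]; rfl
      have e2 : (∑ i ∈ s, (A i).indicator (1 : ℝ → ℝ) a) * V.indicator (1 : ℝ → ℝ) a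
          = ∑ i ∈ s, (A i).indicator (1 : ℝ → ℝ) a := by
        rw [Finset.sum_mul]
        refine Finset.sum_congr rfl fun i hi => ?_
        by_cases h : a ∈ A i
        · simp [h, hAV i hi h]
        · simp [h]
      have e3 : V.indicator (1 : ℝ → ℝ) a * V.indicator (1 : ℝ → ℝ) a = V.indicator (1 : ℝ → ℝ) a := by
        by_cases h : a ∈ V <;> simp [h]
      rw [e1]
      linear_combination (-2 * t) * e2 + t * t * e3
    have h0 : 0 ≤ ∫ a, ((∑ i ∈ s, (A i).indicator (1 : ℝ → ℝ) a)
        - t * V.indicator (1 : ℝ → ℝ) a) ^ 2 := integral_nonneg fun a => sq_nonneg _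
    simp_rw [e] at h0
    have i1 : Integrable (fun a => ∑ i ∈ s, ∑ j ∈ s, (A i ∩ A j).indicator (1 : ℝ → ℝ) a) volume :=
      integrable_finsetSum _ fun i _ => integrable_finsetSum _ fun j _ =>
        hint _ ((hA i).inter (hA j)) (measure_ne_top_of_subset Set.inter_subset_left (hfin i))
    have i2 : Integrable (fun a => ∑ i ∈ s, (A i).indicator (1 : ℝ → ℝ) a) volume :=
      integrable_finsetSum _ fun i _ => hint _ (hA i) (hfin i)
    have i3 := hint V hV hVfin
    rw [integral_add (f := fun a => ∑ i ∈ s, ∑ j ∈ s, (A i ∩ A j).indicator (1 : ℝ → ℝ) a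
        - 2 * t * ∑ i ∈ s, (A i).indicator (1 : ℝ → ℝ) a)
      (i1.sub (i2.const_mul _)) (i3.const_mul _), integral_sub i1 (i2.const_mul _),
      integral_const_mul, integral_const_mul, hintI V hV,
      integral_finsetSum _ (fun i _ => hint _ (hA i) (hfin i)),
      integral_finsetSum _ (fun i _ => integrable_finsetSum _ fun j _ =>
        hint _ ((hA i).inter (hA j)) (measure_ne_top_of_subset Set.inter_subset_left (hfin i)))] at h0
    simp_rw [hintI _ (hA _)] at h0
    have : ∑ i ∈ s, ∫ a, ∑ j ∈ s, (A i ∩ A j).indicator (1 : ℝ → ℝ) a = Q := by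
      refine Finset.sum_congr rfl fun i _ => ?_
      rw [integral_finsetSum _ (fun j _ => 
        hint _ ((hA i).inter (hA j)) (measure_ne_top_of_subset Set.inter_subset_left (hfin i)))]
      exact Finset.sum_congr rfl fun j _ => hintI _ ((hA i).inter (hA j))
    rw [this] at h0
    linarith
  have := discrim_le_zero key
  rw [discrim] at this
  nlinarith

lemma mstp_geom (a b k : ℕ) :
    ∑ j ∈ Finset.Ico a b, (if j ≤ k then (4:ℝ) ^ j / 4 ^ k else 0) ≤ 2 := by
  rw [← Finset.sum_filter]
  calc _ ≤ ∑ j ∈ Finset.range (k + 1), (4:ℝ) ^ j / 4 ^ k := by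
        apply Finset.sum_le_sum_of_subset_of_nonneg
        · intro j; simp
        · intros; positivity
    _ ≤ 2 := by
        rw [← Finset.sum_div, geom_sum_eq (by norm_num), div_le_iff₀ (by positivity), pow_succ]
        have : (0:ℝ) < 4 ^ k := by positivity
        linarith

/-- inverse mod q -/
lemma mstp_find (q : ℕ) (p t N : ℤ) (hq : 0 < q) (h : IsCoprime p (q : ℤ)) :
    ∃ n m : ℤ, N ≤ n ∧ n < N + q ∧ n * p - t = q * m := by
  obtain ⟨u, v, huv⟩ := h
  refine ⟨N + (t * u - N) % q, -t * v - p * ((t * u - N) / q), ?_, ?_, ?_⟩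
  · have := Int.emod_nonneg (t * u - N) (b := (q:ℤ)) (by omega)
    omega
  · have := Int.emod_lt_of_pos (t * u - N) (b := (q:ℤ)) (by omega)
    omega
  · have := Int.emod_add_mul_ediv (t * u - N) q
    linear_combination p * this + t * huv

lemma mstp_approx (x α : ℝ) (N : ℕ) (r : ℚ) (h1 : |α - r| ≤ 1 / ((N + 1) * r.den))
    (h2 : r.den ≤ N) (h3 : N < 8 * r.den) :
    ∃ n : ℕ, ∃ m : ℤ, N ≤ n ∧ n < 2 * N ∧ |α - (m + x) / n| ≤ 24 / N ^ 2 := by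
  have hq := r.den_pos
  obtain ⟨n, m, hn1, hn2, hnm⟩ := mstp_find r.den r.num ⌊r.den * x⌋ N hq
    (Int.isCoprime_iff_gcd_eq_one.2 (by simpa [Int.gcd] using r.reduced))
  lift n to ℕ using (by omega)
  refine ⟨n, m, by omega, by omega, ?_⟩
  have hN : (0:ℝ) < N := by have : 0 < N := by omega
                            exact_mod_cast this
  have hn : (N:ℝ) ≤ n := by exact_mod_cast hn1
  have hn' : (n:ℝ) ≤ 2 * N := by have : n ≤ 2 * N := by omega
                                 exact_mod_cast this
  have hq' : (0:ℝ) < r.den := by exact_mod_cast hq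
  have h3' : (N:ℝ) ≤ 8 * r.den := by exact_mod_cast h3.le
  have hr : (r : ℝ) = r.num / r.den := by exact_mod_cast (Rat.num_div_den r).symm
  have hnm' : (n:ℝ) * r.num - ⌊r.den * x⌋ = r.den * m := by exact_mod_cast hnm
  have f1 := Int.floor_le (r.den * x)
  have f2 := Int.lt_floor_add_one (r.den * x)
  have e : α - (m + x) / n = (α - r) + ((⌊r.den * x⌋ : ℝ) - r.den * x) / (r.den * n) := by
    have hn0 : (n:ℝ) ≠ 0 := by linarith
    have h5 : ((⌊r.den * x⌋ : ℝ) - r.den * x) = n * r.num - r.den * m - r.den * x := by linarith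
    rw [hr, h5]
    field_simp
    ring
  rw [e]
  have b1 : |α - r| ≤ 8 / N ^ 2 := by
    refine h1.trans ?_
    rw [div_le_div_iff₀ (by positivity) (by positivity)]
    nlinarith
  have b2 : |((⌊r.den * x⌋ : ℝ) - r.den * x) / (r.den * n)| ≤ 8 / N ^ 2 := by
    rw [abs_div, abs_of_pos (mul_pos hq' (hN.trans_le hn))]
    have : |((⌊r.den * x⌋ : ℝ) - r.den * x)| ≤ 1 := abs_le.2 ⟨by linarith, by linarith⟩
    rw [div_le_div_iff₀ (mul_pos hq' (hN.trans_le hn)) (by positivity)]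
    have : (N:ℝ) ^ 2 ≤ 8 * (r.den * n) := by nlinarith
    nlinarith [sq_nonneg (N:ℝ)]
  refine (abs_add_le _ _).trans ((add_le_add b1 b2).trans ?_)
  rw [← add_div]
  gcongr
  norm_num

lemma mstp_bad (y ρ : ℝ) (hρ : 0 < ρ) : ∀ᶠ N : ℕ in Filter.atTop, ∃ B : Set ℝ,
    volume.real B ≤ ρ / 4 ∧ volume B ≠ ⊤ ∧ ∀ α : ℝ, |α - y| ≤ ρ / 4 → ∀ r : ℚ,
      |α - r| ≤ 1 / ((N + 1) * r.den) → 8 * r.den ≤ N → α ∈ B := by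
  have hces := (tendsto_one_div_add_atTop_nhds_zero_nat (𝕜 := ℝ)).cesaro
  have hces' := hces.eventually_lt_const (show (0:ℝ) < ρ / 48 by positivity)
  filter_upwards [hces', Filter.eventually_gt_atTop 0] with N hN hN0
  have hNpos : (0:ℝ) < N := by exact_mod_cast hN0
  let P : ℕ → Finset ℤ := fun q => Finset.Icc ⌈q * y - q * ρ / 4 - 1⌉ ⌊q * y + q * ρ / 4 + 1⌋
  have hB : volume.real (⋃ q ∈ Finset.Icc 1 (N / 8), ⋃ p ∈ P q, closedBall ((p:ℝ) / q) (1 / (q * N)))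
      ≤ ρ / 4 := by
    calc _ ≤ ∑ q ∈ Finset.Icc 1 (N / 8), ∑ p ∈ P q, volume.real (closedBall ((p:ℝ) / q) (1 / (q * N))) := by
          refine (measureReal_biUnion_finset_le _ _).trans (Finset.sum_le_sum fun q _ => ?_)
          exact measureReal_biUnion_finset_le _ _
      _ ≤ ∑ q ∈ Finset.Icc 1 (N / 8), (ρ / N + 6 / N * (1 / q)) := by
          refine Finset.sum_le_sum fun q hq => ?_
          have hq1 : 1 ≤ q := (Finset.mem_Icc.1 hq).1
          have hq0 : (0:ℝ) < q := by exact_mod_cast hq1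
          have hc : ((P q).card : ℝ) ≤ q * ρ / 2 + 3 := by
            simp only [P, Int.card_Icc]
            have h1 := Int.floor_le (q * y + q * ρ / 4 + 1)
            have h2 := Int.le_ceil (q * y - q * ρ / 4 - 1)
            have h3 : (((⌊q * y + q * ρ / 4 + 1⌋ + 1 - ⌈q * y - q * ρ / 4 - 1⌉).toNat : ℤ) : ℝ) =
              max ((⌊q * y + q * ρ / 4 + 1⌋ : ℝ) + 1 - ⌈q * y - q * ρ / 4 - 1⌉) 0 := by
              rw [Int.toNat_eq_max]; push_cast; rfl
            rw [Int.cast_natCast] at h3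
            rw [h3]
            refine max_le (by linarith) (by positivity)
          have : ∀ p ∈ P q, volume.real (closedBall ((p:ℝ) / q) (1 / (q * N))) = 2 * (1 / (q * N)) :=
            fun p _ => Real.volume_real_closedBall (by positivity)
          rw [Finset.sum_congr rfl this, Finset.sum_const, nsmul_eq_mul]
          calc _ ≤ (q * ρ / 2 + 3) * (2 * (1 / (q * N))) := by gcongr
            _ = _ := by field_simp; ring
      _ ≤ ρ / 8 + ρ / 8 := by
          rw [Finset.sum_add_distrib, ← Finset.mul_sum]
          refine add_le_add ?_ ?_
          · rw [Finset.sum_const, nsmul_eq_mul]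
            simp only [Nat.card_Icc, Nat.add_sub_cancel]
            have : ((N / 8 : ℕ) : ℝ) ≤ N / 8 := Nat.cast_div_le
            calc _ ≤ (N / 8 : ℝ) * (ρ / N) := by gcongr
              _ = _ := by field_simp
          · have h1 : ∑ q ∈ Finset.Icc 1 (N / 8), (1 / (q:ℝ)) ≤ ∑ i ∈ Finset.range N, (1 / ((i:ℝ) + 1)) := by
              rw [← Finset.Ico_add_one_right_eq_Icc, Finset.sum_Ico_eq_sum_range]
              refine (Finset.sum_le_sum_of_subset_of_nonneg (t := Finset.range N) ?_ ?_).trans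
                (le_of_eq ?_)
              · intro j; simp only [Finset.mem_range]; omega
              · intros; positivity
              · refine Finset.sum_congr rfl fun i _ => ?_
                push_cast; rw [add_comm]
            have h2 : 6 / N * ∑ i ∈ Finset.range N, (1 / ((i:ℝ) + 1)) ≤ ρ / 8 := by
              rw [div_eq_mul_inv, mul_assoc]; linarith
            exact (mul_le_mul_of_nonneg_left h1 (by positivity)).trans h2
      _ = _ := by ring
  refine ⟨_, hB, ?_, ?_⟩
  · refine ((measure_biUnion_finset_le _ _).trans_lt ?_).ne
    refine ENNReal.sum_lt_top.2 fun q _ => (measure_biUnion_finset_le _ _).trans_lt ?_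
    refine ENNReal.sum_lt_top.2 fun p _ => measure_closedBall_lt_top
  · intro α hα r hr h8
    have hq := r.den_pos
    have hq' : (0:ℝ) < r.den := by exact_mod_cast hq
    have hq1 : (1:ℝ) ≤ r.den := by exact_mod_cast hq
    have hrr : (r : ℝ) = r.num / r.den := by exact_mod_cast (Rat.num_div_den r).symm
    have h3 : |α - r| ≤ 1 / (r.den * N) := by
      refine hr.trans ?_
      rw [mul_comm (r.den : ℝ)]
      gcongr
      linarith
    have h4 : |r.den * α - r.num| ≤ 1 := by
      have e : r.den * α - r.num = r.den * (α - r) := by rw [hrr]; field_simp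
      rw [e, abs_mul, abs_of_pos hq']
      calc _ ≤ r.den * (1 / (r.den * (N:ℝ))) := by gcongr
        _ = 1 / N := by field_simp
        _ ≤ 1 := by rw [div_le_one hNpos]; exact_mod_cast hN0
    simp only [Set.mem_iUnion]
    refine ⟨r.den, Finset.mem_Icc.2 ⟨hq, by omega⟩, r.num, ?_, ?_⟩
    · rw [abs_le] at h4 hα
      simp only [P, Finset.mem_Icc, Int.ceil_le, Int.le_floor]
      constructor <;> nlinarith
    · rw [mem_closedBall, Real.dist_eq, ← hrr]
      exact h3

lemma mstp_ubiq (x y ρ : ℝ) (hρ : 0 < ρ) : ∀ᶠ k : ℕ in Filter.atTop, ∃ G : Finset ℝ,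
    (∀ p ∈ G, |p - y| ≤ ρ / 2 ∧ ∃ n : ℕ, ∃ m : ℤ, 2 ^ k ≤ n ∧ n < 2 ^ (k + 1) ∧ n * p = m + x) ∧
    Set.InjOn (fun p : ℝ => ⌊(4:ℝ) ^ k * p⌋) G ∧ ρ / 200 * 4 ^ k ≤ G.card := by
  have hpow : Filter.Tendsto (fun k : ℕ => 2 ^ k) Filter.atTop Filter.atTop :=
    tendsto_pow_atTop_atTop_of_one_lt (by norm_num)
  have h4t : Filter.Tendsto (fun k : ℕ => 24 / (4:ℝ) ^ k) Filter.atTop (nhds 0) :=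
    Filter.Tendsto.const_div_atTop (tendsto_pow_atTop_atTop_of_one_lt (by norm_num)) _
  filter_upwards [hpow.eventually (mstp_bad y ρ hρ),
    h4t.eventually_lt_const (show (0:ℝ) < ρ / 4 by positivity)] with k hk hk4
  obtain ⟨B, hB1, hB2, hB3⟩ := hk
  have h4pos : (0:ℝ) < 4 ^ k := by positivity
  have h24 : (((2 ^ k : ℕ) : ℝ)) ^ 2 = 4 ^ k := by
    push_cast; rw [← pow_mul, mul_comm, pow_mul]; norm_num
  let S : Set ℝ := {p | |p - y| ≤ ρ / 2 ∧ ∃ n : ℕ, ∃ m : ℤ, 2 ^ k ≤ n ∧ n < 2 ^ (k + 1) ∧ n * p = m + x}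
  let f : ℝ → ℤ := fun p => ⌊(4:ℝ) ^ k * p⌋
  obtain ⟨S', hS', hbij⟩ := (Set.surjOn_image f S).exists_bijOn_subset
  have hfin : (f '' S).Finite := by
    refine (Set.finite_Icc ⌊(4:ℝ) ^ k * (y - ρ / 2)⌋ ⌊(4:ℝ) ^ k * (y + ρ / 2)⌋).subset ?_
    rintro _ ⟨p, hp, rfl⟩
    have := abs_le.1 hp.1
    exact ⟨Int.floor_le_floor (by gcongr; linarith), Int.floor_le_floor (by gcongr; linarith)⟩
  have hS'fin : S'.Finite := hbij.finite_iff_finite.2 hfin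
  refine ⟨hS'fin.toFinset, fun p hp => hS' (by simpa using hp), by simpa using hbij.injOn, ?_⟩
  have hcov : closedBall y (ρ / 4) ⊆ B ∪ ⋃ p ∈ hS'fin.toFinset, closedBall p (25 / 4 ^ k) := by
    intro α hα
    rw [mem_closedBall, Real.dist_eq] at hα
    obtain ⟨r, hr1, hr2⟩ := Real.exists_rat_abs_sub_le_and_den_le α (n := 2 ^ k) (by positivity)
    by_cases h8 : 8 * r.den ≤ 2 ^ k
    · exact Or.inl (hB3 α hα r hr1 h8)
    · right
      obtain ⟨n, m, hn1, hn2, hnm⟩ := mstp_approx x α (2 ^ k) r hr1 hr2 (by omega)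
      rw [h24] at hnm
      have hn0 : (n:ℝ) ≠ 0 := by
        have : 0 < 2 ^ k := by positivity
        have : n ≠ 0 := by omega
        exact_mod_cast this
      have hpS : (m + x) / n ∈ S := by
        refine ⟨?_, n, m, hn1, by rw [pow_succ]; omega, by field_simp⟩
        rw [abs_le] at *
        constructor <;> linarith
      obtain ⟨p', hp', hpp⟩ := hbij.surjOn (Set.mem_image_of_mem f hpS)
      simp only [Set.mem_iUnion]
      refine ⟨p', by simpa using hp', ?_⟩
      have h1 := Int.abs_sub_lt_one_of_floor_eq_floor hpp
      rw [← mul_sub, abs_mul, abs_of_pos h4pos, mul_comm, ← lt_div_iff₀ h4pos] at h1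
      rw [mem_closedBall, Real.dist_eq]
      have e : (25:ℝ) / 4 ^ k = 24 / 4 ^ k + 1 / 4 ^ k := by rw [← add_div]; norm_num
      rw [e]
      rw [abs_le] at *
      rw [abs_lt] at h1
      constructor <;> linarith
  have hm : ρ / 2 ≤ ρ / 4 + hS'fin.toFinset.card * (2 * (25 / 4 ^ k)) := by
    calc ρ / 2 = volume.real (closedBall y (ρ / 4)) := by
          rw [Real.volume_real_closedBall (by positivity)]; ring
      _ ≤ volume.real (B ∪ ⋃ p ∈ hS'fin.toFinset, closedBall p (25 / 4 ^ k)) := by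
          refine measureReal_mono hcov (measure_union_ne_top hB2 ?_)
          refine ((measure_biUnion_finset_le _ _).trans_lt ?_).ne
          exact ENNReal.sum_lt_top.2 fun p _ => measure_closedBall_lt_top
      _ ≤ volume.real B + volume.real (⋃ p ∈ hS'fin.toFinset, closedBall p (25 / 4 ^ k)) :=
          measureReal_union_le _ _
      _ ≤ _ := by
          refine add_le_add hB1 ((measureReal_biUnion_finset_le _ _).trans ?_)
          rw [Finset.sum_congr rfl (fun p _ => Real.volume_real_closedBall (by positivity)),
            Finset.sum_const, nsmul_eq_mul]
  have : hS'fin.toFinset.card * (2 * (25 / (4:ℝ) ^ k)) = hS'fin.toFinset.card * 50 / (4:ℝ) ^ k := by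
    ring
  rw [this] at hm
  have h5 : ρ / 4 ≤ hS'fin.toFinset.card * 50 / (4:ℝ) ^ k := by linarith
  rw [le_div_iff₀ h4pos] at h5
  linarith

lemma mstp_pair (Gj Gk : Finset ℝ) (j k : ℕ) (dj dk ρ : ℝ) (hdj : 0 ≤ dj) (hdk : 0 ≤ dk)
    (hdk1 : 4 ^ k * dk ≤ 1)
    (hinj : Set.InjOn (fun p : ℝ => ⌊(4:ℝ) ^ k * p⌋) Gk)
    (hcard : (Gj.card : ℝ) ≤ 2 * ρ * 4 ^ j) :
    ∑ p ∈ Gj, ∑ p' ∈ Gk, volume.real (ball p dj ∩ ball p' dk) ≤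
      8 * ρ * ((4 ^ j * dj) * (4 ^ k * dk)) + 16 * ρ * (4 ^ j / 4 ^ k * (4 ^ k * dk)) := by
  classical
  have h4k : (0:ℝ) < 4 ^ k := by positivity
  have h4j : (0:ℝ) < 4 ^ j := by positivity
  have inner : ∀ p ∈ Gj, ∑ p' ∈ Gk, volume.real (ball p dj ∩ ball p' dk) ≤
      (2 * 4 ^ k * dj + 4) * (2 * dk) := by
    intro p _
    have h1 : ∀ p' ∈ Gk, volume.real (ball p dj ∩ ball p' dk) ≤
        if |p' - p| ≤ dj + dk then 2 * dk else 0 := by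
      intro p' _
      split_ifs with h
      · rw [← Real.volume_real_ball (a := p') hdk]
        exact measureReal_mono Set.inter_subset_right measure_ball_lt_top.ne
      · have : ball p dj ∩ ball p' dk = ∅ := by
          ext z
          simp only [Set.mem_inter_iff, mem_ball, Real.dist_eq, Set.mem_empty_iff_false, iff_false,
            not_and]
          intro h1 h2
          apply h
          rw [abs_lt] at h1 h2
          rw [abs_le]
          constructor <;> linarith
        rw [this]; simp
    refine (Finset.sum_le_sum h1).trans ?_
    rw [← Finset.sum_filter, Finset.sum_const, nsmul_eq_mul]
    refine mul_le_mul_of_nonneg_right ?_ (by positivity)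
    have := mstp_card_le (Gk.filter (fun p' => |p' - p| ≤ dj + dk)) (4 ^ k) (p - (dj + dk))
      (p + (dj + dk)) h4k.le (by linarith) (hinj.mono (fun q hq => (Finset.mem_filter.1 hq).1)) (by
        intro q hq
        have := abs_le.1 (Finset.mem_filter.1 hq).2
        constructor <;> linarith)
    refine this.trans ?_
    nlinarith
  refine (Finset.sum_le_sum inner).trans ?_
  rw [Finset.sum_const, nsmul_eq_mul]
  calc _ ≤ (2 * ρ * 4 ^ j) * ((2 * 4 ^ k * dj + 4) * (2 * dk)) := by gcongr
    _ = _ := by field_simp; ring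

lemma mstp_local (x y ρ : ℝ) (hρ : 0 < ρ) (δ : ℕ → ℝ) (hδ0 : ∀ k, 0 ≤ δ k)
    (hδ1 : ∀ k, 4 ^ k * δ k ≤ 1) (hdiv : ¬ Summable (fun k => 4 ^ k * δ k)) (K : ℕ)
    (V : Set ℝ) (hVm : MeasurableSet V)
    (hV : ∀ k ≥ K, ∀ (n : ℕ) (m : ℤ) (p α : ℝ), 2 ^ k ≤ n → n < 2 ^ (k + 1) → n * p = m + x →
      |α - p| < δ k → α ∈ V) :
    ρ / 720000 ≤ volume.real (V ∩ closedBall y ρ) := by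
  classical
  have h4t : Filter.Tendsto (fun k : ℕ => (4:ℝ) ^ k) Filter.atTop Filter.atTop :=
    tendsto_pow_atTop_atTop_of_one_lt (by norm_num)
  obtain ⟨k0, hk0⟩ := Filter.eventually_atTop.1 ((mstp_ubiq x y ρ hρ).and
    (h4t.eventually_ge_atTop (2 / ρ)))
  set k1 := max k0 K
  have hG : ∀ k : ℕ, ∃ G : Finset ℝ, k1 ≤ k → 
    (∀ p ∈ G, |p - y| ≤ ρ / 2 ∧ ∃ n : ℕ, ∃ m : ℤ, 2 ^ k ≤ n ∧ n < 2 ^ (k + 1) ∧ n * p = m + x) ∧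
    Set.InjOn (fun p : ℝ => ⌊(4:ℝ) ^ k * p⌋) G ∧ ρ / 200 * 4 ^ k ≤ G.card := by
    intro k
    by_cases h : k1 ≤ k
    · obtain ⟨G, hG⟩ := (hk0 k ((le_max_left _ _).trans h)).1
      exact ⟨G, fun _ => hG⟩
    · exact ⟨∅, fun h' => absurd h' h⟩
  choose G hG using hG
  have h4 : ∀ k, k1 ≤ k → 2 ≤ ρ * 4 ^ k := by
    intro k h
    have := (hk0 k ((le_max_left _ _).trans h)).2
    rw [div_le_iff₀ hρ] at this
    linarith
  have hcard : ∀ k, k1 ≤ k → ((G k).card : ℝ) ≤ 2 * ρ * 4 ^ k := by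
    intro k hk
    have := mstp_card_le (G k) (4 ^ k) (y - ρ / 2) (y + ρ / 2) (by positivity) (by linarith)
      (hG k hk).2.1 (by
        intro p hp
        have := abs_le.1 ((hG k hk).1 p hp).1
        constructor <;> linarith)
    have := h4 k hk
    nlinarith
  set u : ℕ → ℝ := fun k => 4 ^ k * δ k with hu
  have hu0 : ∀ k, 0 ≤ u k := fun k => mul_nonneg (by positivity) (hδ0 k)
  obtain ⟨b, hb⟩ : ∃ b, 1 ≤ ∑ k ∈ Finset.Ico k1 b, u k := by
    have h1 := (not_summable_iff_tendsto_nat_atTop_of_nonneg hu0).1 hdiv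
    obtain ⟨b, hb1, hb2⟩ := ((h1.eventually_ge_atTop (1 + ∑ i ∈ Finset.range k1, u i)).and
      (Filter.eventually_ge_atTop k1)).exists
    exact ⟨b, by rw [Finset.sum_Ico_eq_sub _ hb2]; linarith⟩
  set U := ∑ k ∈ Finset.Ico k1 b, u k with hU
  have hCE := mstp_CE ((Finset.Ico k1 b).sigma G) (fun i => ball i.2 (δ i.1))
    (fun i => measurableSet_ball) (fun i => measure_ball_lt_top.ne) (V ∩ closedBall y ρ)
    (hVm.inter measurableSet_closedBall)
    (measure_ne_top_of_subset Set.inter_subset_right measure_closedBall_lt_top.ne) (by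
      rintro ⟨k, p⟩ hi α hα
      simp only [Finset.mem_sigma, Finset.mem_Ico] at hi
      simp only [mem_ball, Real.dist_eq] at hα
      obtain ⟨⟨hk, _⟩, hp⟩ := hi
      obtain ⟨hpy, n, m, hn1, hn2, hnm⟩ := (hG k hk).1 p hp
      refine ⟨hV k ((le_max_right _ _).trans hk) n m p α hn1 hn2 hnm hα, ?_⟩
      rw [mem_closedBall, Real.dist_eq]
      have h2 := h4 k hk
      have h3 := hδ1 k
      have h5 : δ k ≤ ρ / 2 := by
        by_contra hcon
        have : (0:ℝ) < 4 ^ k := by positivity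
        nlinarith
      rw [abs_le] at *
      rw [abs_lt] at hα
      constructor <;> linarith)
  rw [Finset.sum_sigma, Finset.sum_sigma] at hCE
  simp only [Finset.sum_sigma] at hCE
  have hlow : ρ / 100 * U ≤ ∑ k ∈ Finset.Ico k1 b, ∑ p ∈ G k, volume.real (ball p (δ k)) := by
    rw [hU, Finset.mul_sum]
    refine Finset.sum_le_sum fun k hk => ?_
    have hk1 := (Finset.mem_Ico.1 hk).1
    rw [Finset.sum_congr rfl (fun p _ => Real.volume_real_ball (hδ0 k)), Finset.sum_const,
      nsmul_eq_mul]
    have := mul_le_mul_of_nonneg_right (hG k hk1).2.2 (hδ0 k)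
    simp only [hu]
    nlinarith
  have hup : ∑ j ∈ Finset.Ico k1 b, ∑ p ∈ G j, ∑ k ∈ Finset.Ico k1 b, ∑ p' ∈ G k,
      volume.real (ball p (δ j) ∩ ball p' (δ k)) ≤ 72 * ρ * U ^ 2 := by
    have hjk : ∀ j ∈ Finset.Ico k1 b, ∀ k ∈ Finset.Ico k1 b,
        ∑ p ∈ G j, ∑ p' ∈ G k, volume.real (ball p (δ j) ∩ ball p' (δ k)) ≤
        8 * ρ * (u j * u k) + 16 * ρ * ((if j ≤ k then (4:ℝ) ^ j / 4 ^ k else 0) * u k) +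
          16 * ρ * ((if k ≤ j then (4:ℝ) ^ k / 4 ^ j else 0) * u j) := by
      intro j hj k hk
      have hj1 := (Finset.mem_Ico.1 hj).1
      have hk1 := (Finset.mem_Ico.1 hk).1
      have huj := hu0 j
      have huk := hu0 k
      rcases le_total j k with h | h
      · have := mstp_pair (G j) (G k) j k (δ j) (δ k) ρ (hδ0 j) (hδ0 k) (hδ1 k)
          (hG k hk1).2.1 (hcard j hj1)
        refine this.trans ?_
        rw [if_pos h]
        refine le_add_of_nonneg_right ?_
        split_ifs <;> positivity
      · have := mstp_pair (G k) (G j) k j (δ k) (δ j) ρ (hδ0 k) (hδ0 j) (hδ1 j)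
          (hG j hj1).2.1 (hcard k hk1)
        rw [Finset.sum_comm] at this
        simp_rw [Set.inter_comm (ball _ (δ j))]
        refine this.trans ?_
        rw [if_pos h]
        have h0 : 0 ≤ 16 * ρ * ((if j ≤ k then (4:ℝ) ^ j / 4 ^ k else 0) * u k) := by
          split_ifs <;> positivity
        simp only [hu] at *
        linarith
    calc _ = ∑ j ∈ Finset.Ico k1 b, ∑ k ∈ Finset.Ico k1 b, ∑ p ∈ G j, ∑ p' ∈ G k,
          volume.real (ball p (δ j) ∩ ball p' (δ k)) := by
          refine Finset.sum_congr rfl fun j _ => Finset.sum_comm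
      _ ≤ ∑ j ∈ Finset.Ico k1 b, ∑ k ∈ Finset.Ico k1 b, (8 * ρ * (u j * u k) +
          16 * ρ * ((if j ≤ k then (4:ℝ) ^ j / 4 ^ k else 0) * u k) +
          16 * ρ * ((if k ≤ j then (4:ℝ) ^ k / 4 ^ j else 0) * u j)) :=
          Finset.sum_le_sum fun j hj => Finset.sum_le_sum fun k hk => hjk j hj k hk
      _ = 8 * ρ * (U * U) + 16 * ρ * (∑ j ∈ Finset.Ico k1 b, ∑ k ∈ Finset.Ico k1 b,
            (if j ≤ k then (4:ℝ) ^ j / 4 ^ k else 0) * u k) +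
          16 * ρ * (∑ j ∈ Finset.Ico k1 b, ∑ k ∈ Finset.Ico k1 b,
            (if k ≤ j then (4:ℝ) ^ k / 4 ^ j else 0) * u j) := by
          simp only [Finset.sum_add_distrib, ← Finset.mul_sum, hU, Finset.sum_mul_sum]
      _ ≤ 8 * ρ * (U * U) + 16 * ρ * (2 * U) + 16 * ρ * (2 * U) := by
          have hs : ∑ j ∈ Finset.Ico k1 b, ∑ k ∈ Finset.Ico k1 b,
            (if k ≤ j then (4:ℝ) ^ k / 4 ^ j else 0) * u j ≤ 2 * U := by
            rw [hU, Finset.mul_sum]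
            refine Finset.sum_le_sum fun j _ => ?_
            rw [← Finset.sum_mul]
            exact mul_le_mul_of_nonneg_right (mstp_geom k1 b j) (hu0 j)
          gcongr
          rw [Finset.sum_comm]
          exact hs
      _ ≤ _ := by
          have hUU : U ≤ U ^ 2 := by nlinarith
          have := mul_le_mul_of_nonneg_left hUU hρ.le
          nlinarith
  have hU2 : 0 < U ^ 2 := by positivity
  have hv : 0 ≤ volume.real (V ∩ closedBall y ρ) := measureReal_nonneg
  have h1 : (ρ / 100 * U) ^ 2 ≤ volume.real (V ∩ closedBall y ρ) * (72 * ρ * U ^ 2) :=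
    (pow_le_pow_left₀ (by positivity) hlow 2).trans (hCE.trans (mul_le_mul_of_nonneg_left hup hv))
  have h2 : ρ * (ρ / 720000) * (72 * U ^ 2) ≤ 
      ρ * volume.real (V ∩ closedBall y ρ) * (72 * U ^ 2) := by
    refine le_trans (le_of_eq ?_) (h1.trans (le_of_eq ?_)) <;> ring
  exact le_of_mul_le_mul_left (le_of_mul_le_mul_right h2 (by positivity)) hρ

lemma mstp_density (c : ℝ) (hc : 0 < c) (V : Set ℝ) (hV : MeasurableSet V)
    (h : ∀ y ρ : ℝ, 0 < ρ → ρ * c ≤ volume.real (V ∩ closedBall y ρ)) :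
    ∀ᵐ α : ℝ, α ∈ V := by
  filter_upwards [Besicovitch.ae_tendsto_measure_inter_div_of_measurableSet (volume : Measure ℝ) hV]
    with y hy
  by_contra hyV
  rw [Set.indicator_of_notMem hyV] at hy
  have h1 := hy.eventually_lt_const (show (0 : ENNReal) < ENNReal.ofReal (c / 2) by simpa using hc)
  obtain ⟨ρ, hρ1, hρ0⟩ := (h1.and self_mem_nhdsWithin).exists
  have hρ : 0 < ρ := hρ0
  have h2 := h y ρ hρ
  rw [Real.volume_closedBall, ENNReal.div_lt_iff (Or.inl (by simp [hρ])) (Or.inl ENNReal.ofReal_ne_top),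
    ← ENNReal.ofReal_mul (by positivity)] at hρ1
  have h3 : volume.real (V ∩ closedBall y ρ) < c / 2 * (2 * ρ) := by
    rw [measureReal_def]
    rw [ENNReal.lt_ofReal_iff_toReal_lt (measure_ne_top_of_subset Set.inter_subset_right measure_closedBall_lt_top.ne)] at hρ1
    exact hρ1
  linarith

lemma mstp_real (x : ℝ) (r : ℕ → ℝ) (hr : ∀ k, 0 ≤ r k)
    (hmono : ∀ m n, 0 < m → m ≤ n → r n ≤ r m) (hdiv : ¬ Summable r) :
    ∀ᵐ α : ℝ, ∀ K : ℕ, ∃ n : ℕ, K ≤ n ∧ 0 < n ∧ ∃ m : ℤ, |n * α - x - m| < r n := by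
  rw [ae_all_iff]
  intro K
  let V : Set ℝ := {α | ∃ n : ℕ, K ≤ n ∧ 0 < n ∧ ∃ m : ℤ, |n * α - x - m| < r n}
  have hVo : IsOpen V := by
    have : V = ⋃ n : ℕ, ⋃ _ : K ≤ n, ⋃ _ : 0 < n, ⋃ m : ℤ, {α : ℝ | |n * α - x - m| < r n} := by
      ext; simp only [V, Set.mem_iUnion, exists_prop]; rfl
    rw [this]
    refine isOpen_iUnion fun n => isOpen_iUnion fun _ => isOpen_iUnion fun _ => isOpen_iUnion fun m =>
      isOpen_lt (by fun_prop) (by fun_prop)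
  let a : ℕ → ℝ := fun k => 2 ^ (k + 1) * r (2 ^ (k + 1))
  have ha : ¬ Summable a := by
    have h1 := (summable_condensed_iff_of_nonneg hr (fun m n => hmono m n)).not.2 hdiv
    exact fun h => h1 ((summable_nat_add_iff (f := fun k => 2 ^ k * r (2 ^ k)) 1).1 h)
  have ha0 : ∀ k, 0 ≤ a k := fun k => mul_nonneg (by positivity) (hr _)
  have hmin : ¬ Summable (fun k => min (a k) 1) := by
    intro h
    apply ha
    have h0 := h.tendsto_atTop_zero.eventually_lt_const (show (0:ℝ) < 1 by norm_num)
    refine (summable_congr_atTop ?_).1 h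
    filter_upwards [h0] with k hk
    rcases min_lt_iff.1 hk with h | h
    · exact min_eq_left h.le
    · exact absurd h (lt_irrefl _)
  refine mstp_density (1 / 720000) (by norm_num) V hVo.measurableSet fun y ρ hρ => ?_
  have := mstp_local x y ρ hρ (fun k => min (a k) 1 / 4 ^ (k + 1))
    (fun k => div_nonneg (le_min (ha0 k) zero_le_one) (by positivity))
    (fun k => ?_) (fun h => hmin ?_) K V hVo.measurableSet ?_
  · linarith
  · have : min (a k) 1 ≤ 1 := min_le_right _ _
    have e : (4:ℝ) ^ k * (min (a k) 1 / 4 ^ (k + 1)) = min (a k) 1 / 4 := by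
      rw [pow_succ]; field_simp
    rw [e]; linarith
  · have e : ∀ k, min (a k) 1 = 4 * ((4:ℝ) ^ k * (min (a k) 1 / 4 ^ (k + 1))) := by
      intro k
      rw [pow_succ]; field_simp
    exact (h.mul_left 4).congr fun k => (e k).symm
  · intro k hk n m p α hn1 hn2 hnm hα
    have hkn : k < 2 ^ k := Nat.lt_two_pow_self
    have hnpos : 0 < n := by omega
    refine ⟨n, by omega, hnpos, m, ?_⟩
    have e : n * α - x - m = n * (α - p) := by linear_combination hnm
    have hn0 : (0:ℝ) < n := by exact_mod_cast hnpos
    rw [e, abs_mul, abs_of_pos hn0]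
    have hn2' : (n:ℝ) ≤ 2 ^ (k + 1) := by exact_mod_cast hn2.le
    have h4 : (4:ℝ) ^ (k + 1) = 2 ^ (k + 1) * 2 ^ (k + 1) := by
      rw [← mul_pow]; norm_num
    calc _ < n * (min (a k) 1 / 4 ^ (k + 1)) := by gcongr
      _ ≤ 2 ^ (k + 1) * (a k / 4 ^ (k + 1)) := by
          have : 0 ≤ min (a k) 1 := le_min (ha0 k) zero_le_one
          gcongr
          exact min_le_left _ _
      _ = r (2 ^ (k + 1)) := by
          simp only [a]; rw [h4]; field_simp
      _ ≤ r n := hmono _ _ hnpos hn2.le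

theorem expanding_circle_maps_MSTP (x : UnitAddCircle) (r : ℕ+ → ℝ)
    (hr : ∀ k, 0 ≤ r k) (hmono : ∀ k : ℕ+, r (k + 1) ≤ r k)
    (hdiv : ∑' k : ℕ+, volume (ball x (r k)) = ⊤) :
    ∀ᵐ α ∂(volume : Measure UnitAddCircle),
      {k : ℕ+ | ((k : ℕ) • α) ∈ ball x (r k)}.Infinite := by
  obtain ⟨x, rfl⟩ := QuotientAddGroup.mk_surjective x
  have hanti : Antitone r := by
    intro m n hmn
    induction n using PNat.recOn with
    | one => 
      have : m = 1 := le_antisymm hmn one_le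
      rw [this]
    | succ n ih =>
      rcases hmn.lt_or_eq with h | h
      · exact (hmono n).trans (ih (PNat.lt_add_one_iff.1 h))
      · rw [h]
  let R : ℕ → ℝ := fun n => if h : 0 < n then r ⟨n, h⟩ else 0
  have hR : ∀ k : ℕ+, R k = r k := fun k => by
    simp only [R, dif_pos k.pos]; rfl
  have hR0 : ∀ n, 0 ≤ R n := fun n => by
    simp only [R]; split_ifs
    · exact hr _
    · exact le_rfl
  have hRm : ∀ m n, 0 < m → m ≤ n → R n ≤ R m := by
    intro m n hm hmn
    simp only [R, dif_pos hm, dif_pos (hm.trans_le hmn)]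
    exact hanti hmn
  have hRd : ¬ Summable R := by
    intro h
    have h1 : Summable r := by
      have := h.comp_injective PNat.coe_injective
      exact this.congr hR
    have h2 : ∑' k : ℕ+, volume (ball (x : UnitAddCircle) (r k)) ≤
        ∑' k : ℕ+, ENNReal.ofReal (2 * r k) := by
      refine ENNReal.tsum_le_tsum fun k => ?_
      refine (measure_mono ball_subset_closedBall).trans ?_
      rw [AddCircle.volume_closedBall]
      exact ENNReal.ofReal_le_ofReal (min_le_right _ _)
    have h3 := (h1.mul_left 2).tsum_ofReal_lt_top
    exact absurd hdiv (h2.trans_lt h3).ne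
  have hreal := mstp_real x R hR0 hRm hRd
  have hmp := UnitAddCircle.measurePreserving_mk 0
  have hmeas : MeasurableSet {α : UnitAddCircle | {k : ℕ+ | ((k : ℕ) • α) ∈ ball (x : UnitAddCircle) (r k)}.Infinite} := by
    have : {α : UnitAddCircle | {k : ℕ+ | ((k : ℕ) • α) ∈ ball (x : UnitAddCircle) (r k)}.Infinite} =
      ⋂ K : ℕ+, ⋃ k : ℕ+, ⋃ _ : K < k, {α : UnitAddCircle | ((k : ℕ) • α) ∈ ball (x : UnitAddCircle) (r k)} := by
      ext α
      simp only [Set.mem_ofPred_eq, Set.mem_iInter, Set.mem_iUnion, Set.infinite_iff_exists_gt,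
        exists_prop]
      exact forall_congr' fun K => exists_congr fun k => and_comm
    rw [this]
    refine MeasurableSet.iInter fun K => MeasurableSet.iUnion fun k => MeasurableSet.iUnion fun _ => ?_
    exact (isOpen_ball.preimage (continuous_nsmul (k : ℕ))).measurableSet
  rw [← hmp.map_eq, ae_map_iff hmp.measurable.aemeasurable hmeas]
  refine ae_restrict_of_ae ?_
  filter_upwards [hreal] with α hα
  rw [Set.infinite_iff_exists_gt]
  intro K
  obtain ⟨n, hn1, hn0, m, hm⟩ := hα (K + 1)
  refine ⟨⟨n, hn0⟩, ?_, ?_⟩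
  · have e : ((n • (α : UnitAddCircle)) - (x : UnitAddCircle)) = ((n * α - x - m : ℝ) : UnitAddCircle) := by
      have h0 : ((m : ℝ) : UnitAddCircle) = 0 := by
        rw [AddCircle.coe_eq_zero_iff]; exact ⟨m, by simp⟩
      rw [AddCircle.coe_sub, h0, sub_zero, AddCircle.coe_sub, ← nsmul_eq_mul, AddCircle.coe_nsmul]
    have hR' : R n = r ⟨n, hn0⟩ := hR ⟨n, hn0⟩
    rw [hR'] at hm
    simp only [mem_ball, dist_eq_norm]
    change ‖n • (α : UnitAddCircle) - (x : UnitAddCircle)‖ < _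
    rw [e]
    refine lt_of_le_of_lt ?_ hm
    rw [UnitAddCircle.norm_eq]
    simpa using round_le (n * α - x - m) 0
  · change (K : ℕ) < n
    omega
end

section
/- Let ν be a Borel probability measure on the circle 𝕋¹ = ℝ/ℤ, and let f : 𝕋¹ → 𝕋¹ be an orientation-preserving homeomorphism preserving ν, admitting a lift F : ℝ → ℝ (a strictly increasing continuous bijection with F(t+1) = F(t)+1 for all t, whose projection to ℝ/ℤ is f) whose rotation number τ(F) = lim_{n→∞} Fⁿ(0)/n is irrational. Then there exist a point x ∈ 𝕋¹ and a radius sequence r : ℕ → ℝ_{≥0} such that ∑_{n=0}^∞ ν(B(x, r(n))) = ∞ and yet ν( ⋂_{N ∈ ℕ} ⋃_{n ≥ N} (fⁿ)⁻¹( B(x, r(n)) ) ) = 0. In particular, the dynamical system (𝕋¹, ν, ℕ, f) does not have the shrinking target property. -/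
open MeasureTheory Metric Filter

/-- A continuous factor map onto the irrational rotation (Poincaré). -/
theorem stp_exists_factor
    (f : UnitAddCircle ≃ₜ UnitAddCircle)
    (F : ℝ → ℝ) (hFmono : StrictMono F)
    (hFbij : Function.Bijective F) (hFper : ∀ t : ℝ, F (t + 1) = F t + 1)
    (hFlift : ∀ t : ℝ, f ((t : ℝ) : UnitAddCircle) = ((F t : ℝ) : UnitAddCircle))
    (τ : ℝ) (hτ : Tendsto (fun m : ℕ => F^[m] 0 / (m : ℝ)) atTop (nhds τ))
    (hirr : Irrational τ) :
    ∃ H : UnitAddCircle → UnitAddCircle, Continuous H ∧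
      ∀ y, H (f y) = H y + (τ : UnitAddCircle) := by
  let G : CircleDeg1Lift := ⟨⟨F, hFmono.monotone⟩, hFper⟩
  have hG : ∀ t, G t = F t := fun _ => rfl
  have hGτ : CircleDeg1Lift.translationNumber G = τ := by
    refine tendsto_nhds_unique (CircleDeg1Lift.tendsto_translation_number₀ G) ?_
    refine hτ.congr fun n => ?_
    rw [CircleDeg1Lift.coe_pow]
    rfl
  obtain ⟨h, hh⟩ := CircleDeg1Lift.semiconj_of_isUnit_of_translationNumber_eq (f₁ := G)
    (f₂ := CircleDeg1Lift.translate (Multiplicative.ofAdd τ))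
    (CircleDeg1Lift.isUnit_iff_bijective.2 hFbij) (Units.isUnit _)
    (by rw [hGτ, CircleDeg1Lift.translationNumber_translate])
  have hhF : ∀ t, h (F t) = τ + h t := fun t => by
    have := hh t
    rwa [CircleDeg1Lift.translate_apply] at this
  have hh1 : ∀ t, h (t + 1) = h t + 1 := h.map_add_one
  have hinv : ∀ g ∈ AddSubgroup.closure ({τ, 1} : Set ℝ), ∀ t, ∃ s, h s = h t + g := by
    intro g hg
    induction hg using AddSubgroup.closure_induction'' with
    | zero => exact fun t => ⟨t, by simp⟩
    | mem x hx =>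
      intro t
      rcases hx with rfl | rfl
      · exact ⟨F t, by rw [hhF, add_comm]⟩
      · exact ⟨t + 1, hh1 t⟩
    | neg_mem x hx =>
      intro t
      rcases hx with rfl | rfl
      · obtain ⟨s, rfl⟩ := hFbij.2 t
        exact ⟨s, by rw [hhF]; ring⟩
      · refine ⟨t - 1, ?_⟩
        have := hh1 (t - 1)
        rw [sub_add_cancel] at this
        rw [this]; ring
    | add x y _ _ ihx ihy =>
      intro t
      obtain ⟨s, hs⟩ := ihx t
      obtain ⟨u, hu⟩ := ihy s
      exact ⟨u, by rw [hu, hs]; ring⟩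
  have hdense : Dense (AddSubgroup.closure ({τ, 1} : Set ℝ) : Set ℝ) :=
    dense_addSubgroupClosure_pair_iff.2 (by simpa using hirr)
  have hrange : DenseRange h := by
    have h2 : Dense ((Homeomorph.addLeft (h 0)) '' (AddSubgroup.closure ({τ, 1} : Set ℝ) : Set ℝ)) :=
      (Homeomorph.addLeft (h 0)).surjective.denseRange.dense_image
        (Homeomorph.addLeft (h 0)).continuous hdense
    refine h2.mono ?_
    rintro _ ⟨g, hg, rfl⟩
    obtain ⟨s, hs⟩ := hinv g hg 0
    exact ⟨s, hs⟩
  have hcont : Continuous h := h.monotone.continuous_of_denseRange hrange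
  have hper : Function.Periodic (fun t : ℝ => ((h t : ℝ) : UnitAddCircle)) 1 := by
    intro t
    simp only [hh1]
    rw [AddCircle.coe_add, AddCircle.coe_period, add_zero]
  refine ⟨hper.lift, ?_, ?_⟩
  · exact continuous_coinduced_dom.2 ((AddCircle.continuous_mk' 1).comp hcont)
  · intro y
    induction y using QuotientAddGroup.induction_on with
    | H t =>
      rw [hFlift, hper.lift_coe, hper.lift_coe, hhF, AddCircle.coe_add, add_comm]

theorem stp_key
    (ν : Measure UnitAddCircle) [IsProbabilityMeasure ν]
    (f : UnitAddCircle ≃ₜ UnitAddCircle) (hf : MeasurePreserving f ν ν)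
    (H : UnitAddCircle → UnitAddCircle) (hH : Continuous H) (τ : ℝ) (hirr : Irrational τ)
    (hs : ∀ y, H (f y) = H y + (τ : UnitAddCircle)) (x : UnitAddCircle)
    (ε : ENNReal) (hε : 0 < ε) :
    ∃ ρ : ℝ, 0 < ρ ∧ ∃ E : Set UnitAddCircle, ν E ≤ ε ∧
      ∃ᶠ n : ℕ in atTop, (⇑f)^[n] ⁻¹' ball x ρ ⊆ E := by
  have hit : ∀ n y, H ((⇑f)^[n] y) = H y + n • (τ : UnitAddCircle) := by
    intro n
    induction n with
    | zero => simp
    | succ n ih =>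
      intro y
      rw [Function.iterate_succ_apply', hs, ih, succ_nsmul, add_assoc]
  have hfib : ν (H ⁻¹' {H x}) = 0 := by
    by_contra hne
    obtain ⟨y, hy, m, hm, hmy⟩ := hf.exists_mem_iterate_mem
      (hH.measurable (measurableSet_singleton _)).nullMeasurableSet hne
    simp only [Set.mem_preimage, Set.mem_singleton_iff] at hy hmy
    rw [hit, hy, add_eq_left, ← AddCircle.coe_nsmul, AddCircle.coe_eq_zero_iff] at hmy
    obtain ⟨k, hk⟩ := hmy
    refine (hirr.natCast_mul hm).ne_int k ?_
    simpa using hk.symm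
  have hmap : (ν.map H) {H x} < ε := by
    rw [Measure.map_apply hH.measurable (measurableSet_singleton _), hfib]; exact hε
  have : IsFiniteMeasure (ν.map H) := inferInstance
  obtain ⟨U, hxU, hUo, hU⟩ := Set.exists_isOpen_lt_of_lt _ _ hmap
  obtain ⟨η, hη, hball⟩ := Metric.isOpen_iff.1 hUo (H x) (hxU rfl)
  obtain ⟨ρ, hρ, hρη⟩ := Metric.continuous_iff.1 hH x (η / 2) (by positivity)
  refine ⟨ρ, hρ, H ⁻¹' U, ?_, ?_⟩
  · rw [← Measure.map_apply hH.measurable hUo.measurableSet]; exact hU.le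
  · rw [frequently_atTop]
    intro N
    obtain ⟨K, hK⟩ := exists_nat_one_div_lt (show (0 : ℝ) < η / 2 by positivity)
    have : Fact ((0 : ℝ) < 1) := ⟨one_pos⟩
    obtain ⟨j, hj, hjn⟩ := AddCircle.exists_norm_nsmul_le (T := (1 : ℝ))
      ((N + 1) • (τ : UnitAddCircle)) (n := K + 1) (Nat.succ_pos _)
    refine ⟨j * (N + 1), ?_, ?_⟩
    · have := hj.1
      nlinarith
    · intro y hy
      apply hball
      have h1 := hρη _ hy
      rw [hit, mul_smul] at h1
      have h2 : ‖j • (N + 1) • (τ : UnitAddCircle)‖ < η / 2 := by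
        refine lt_of_le_of_lt hjn (lt_of_le_of_lt ?_ hK)
        apply one_div_le_one_div_of_le
        · positivity
        · push_cast; linarith
      rw [mem_ball]
      calc dist (H y) (H x) ≤ dist (H y) (H y + j • (N + 1) • (τ : UnitAddCircle))
            + dist (H y + j • (N + 1) • (τ : UnitAddCircle)) (H x) := dist_triangle _ _ _
        _ < η / 2 + η / 2 := by
            refine add_lt_add ?_ h1
            rw [dist_self_add_right]; exact h2
        _ = η := by ring

theorem irrational_rotation_number_homeomorphism_not_STP
    (ν : Measure UnitAddCircle) [IsProbabilityMeasure ν]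
    (f : UnitAddCircle ≃ₜ UnitAddCircle) (hf : MeasurePreserving f ν ν)
    (F : ℝ → ℝ) (hFmono : StrictMono F) (hFcont : Continuous F)
    (hFbij : Function.Bijective F) (hFper : ∀ t : ℝ, F (t + 1) = F t + 1)
    (hFlift : ∀ t : ℝ, f ((t : ℝ) : UnitAddCircle) = ((F t : ℝ) : UnitAddCircle))
    (τ : ℝ) (hτ : Tendsto (fun m : ℕ => F^[m] 0 / (m : ℝ)) atTop (nhds τ))
    (hirr : Irrational τ) :
    ∃ (x : UnitAddCircle) (r : ℕ → ℝ), (∀ n, 0 ≤ r n) ∧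
      (∑' n : ℕ, ν (ball x (r n)) = ⊤) ∧
      ν (⋂ N : ℕ, ⋃ n ≥ N, (⇑f)^[n] ⁻¹' ball x (r n)) = 0 := by
  obtain ⟨H, hH, hs⟩ := stp_exists_factor f F hFmono hFbij hFper hFlift τ hτ hirr
  obtain ⟨x, -, hx⟩ := exists_mem_forall_mem_nhdsWithin_pos_measure (μ := ν) (s := Set.univ)
    (by simp)
  have key := fun k : ℕ => stp_key ν f hf H hH τ hirr hs x ((2 : ENNReal)⁻¹ ^ k)
    (ENNReal.pow_pos (by simp) k)
  choose ρ hρ E hE hfreq using key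
  have hpos : ∀ k, ν (ball x (ρ k)) ≠ 0 := fun k =>
    (hx _ (by rw [nhdsWithin_univ]; exact ball_mem_nhds x (hρ k))).ne'
  have hM : ∀ k, ∃ M : ℕ, 1 ≤ (M : ENNReal) * ν (ball x (ρ k)) := by
    intro k
    obtain ⟨M, hM⟩ := ENNReal.exists_nat_mul_gt (hpos k) ENNReal.one_ne_top
    exact ⟨M, hM.le⟩
  choose M hM using hM
  obtain ⟨φ, hφ, hφE⟩ := extraction_forall_of_frequently
    (P := fun j n => ∀ s : (Σ k, Fin (M k)), Encodable.encode s = j →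
      (⇑f)^[n] ⁻¹' ball x (ρ s.1) ⊆ E s.1) (by
      intro j
      by_cases hj : ∃ s : (Σ k, Fin (M k)), Encodable.encode s = j
      · obtain ⟨s, rfl⟩ := hj
        refine (hfreq s.1).mono ?_
        intro n hn s' hs'
        rw [Encodable.encode_injective hs']
        exact hn
      · refine Eventually.frequently (Eventually.of_forall ?_)
        intro n s hs
        exact (hj ⟨s, hs⟩).elim)
  let g : (Σ k, Fin (M k)) → ℕ := fun s => φ (Encodable.encode s)
  have hg : Function.Injective g := hφ.injective.comp Encodable.encode_injective
  have hgE : ∀ s, (⇑f)^[g s] ⁻¹' ball x (ρ s.1) ⊆ E s.1 := fun s => hφE _ s rfl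
  let r : ℕ → ℝ := Function.extend g (fun s => ρ s.1) 0
  have hrg : ∀ s, r (g s) = ρ s.1 := fun s => hg.extend_apply _ _ s
  have hr0 : ∀ n, (¬ ∃ s, g s = n) → r n = 0 := fun n hn =>
    Function.extend_apply' _ _ _ hn
  refine ⟨x, r, ?_, ?_, ?_⟩
  · intro n
    by_cases hn : ∃ s, g s = n
    · obtain ⟨s, rfl⟩ := hn
      rw [hrg]; exact (hρ _).le
    · rw [hr0 n hn]
  · rw [eq_top_iff]
    calc (⊤ : ENNReal) = ∑' _ : ℕ, (1 : ENNReal) := by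
          rw [ENNReal.tsum_const_eq_top_of_ne_zero one_ne_zero]
      _ ≤ ∑' k : ℕ, (M k : ENNReal) * ν (ball x (ρ k)) := ENNReal.tsum_le_tsum hM
      _ = ∑' s : (Σ k, Fin (M k)), ν (ball x (ρ s.1)) := by
          rw [ENNReal.tsum_sigma']
          simp [tsum_fintype]
      _ = ∑' s : (Σ k, Fin (M k)), ν (ball x (r (g s))) := by simp only [hrg]
      _ ≤ _ := ENNReal.tsum_comp_le_tsum_of_injective hg fun n => ν (ball x (r n))
  · have hnull : ν {y | ∃ᶠ k : ℕ in atTop, y ∈ E k} = 0 := by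
      apply measure_setOf_frequently_eq_zero
      refine ne_top_of_le_ne_top ?_ (ENNReal.tsum_le_tsum hE)
      rw [ENNReal.tsum_geometric_two]
      simp
    refine measure_mono_null ?_ hnull
    intro y hy
    simp only [Set.mem_iInter, Set.mem_iUnion, exists_prop] at hy
    by_contra hfin
    rw [Set.mem_setOf_eq, not_frequently, eventually_atTop] at hfin
    obtain ⟨K, hK⟩ := hfin
    have hfinite : (g '' {s | s.1 < K}).Finite := by
      apply Set.Finite.image
      have : {s : (Σ k, Fin (M k)) | s.1 < K} =
          ((Finset.range K).sigma fun k => (Finset.univ : Finset (Fin (M k)))) := by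
        ext s; simp
      rw [this]
      exact Finset.finite_toSet _
    obtain ⟨B, hB⟩ := hfinite.bddAbove
    obtain ⟨n, hn, hny⟩ := hy (B + 1)
    by_cases hne : ∃ s, g s = n
    · obtain ⟨s, rfl⟩ := hne
      rw [hrg] at hny
      have hyE := hgE s hny
      have hsK : s.1 < K := by
        by_contra hlt
        exact hK _ (not_lt.1 hlt) hyE
      have := hB ⟨s, hsK, rfl⟩
      omega
    · rw [hr0 n hne] at hny
      simp at hny
end
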